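/- For every prime p, τ(p) = 0 if and only if (200/3)·(σ_{(7,3)}(p) + σ_{(3,7)}(p)) − 294·σ_{(5,5)}(p) = p^11/396 − 5p^7/6 + 137p^5/36 + 19p^3/9 − 1205p/198 − 1. (In particular, Lehmer's conjecture that τ never vanishes holds at primes if and only if this equality fails for every prime p.) -/

import Mathlib

open Finset

/-- Depth-two multiple divisor sum `σ_{(s,t)}(n)`: the sum of `m1^s · m2^t` over all
quadruples of positive integers `((m1, m2), (n1, n2))` with `m1·n1 + m2·n2 = n` and `n1 < n2`. -/
def sigmaPow2 (s t n : ℕ) : ℕ :=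
  ∑ p ∈ ((Finset.Icc 1 n ×ˢ Finset.Icc 1 n) ×ˢ (Finset.Icc 1 n ×ˢ Finset.Icc 1 n)).filter
      (fun p => p.1.1 * p.2.1 + p.1.2 * p.2.2 = n ∧ p.2.1 < p.2.2),
    p.1.1 ^ s * p.1.2 ^ t

/-- Ramanujan's tau function: the coefficient of `q^n` in `q · ∏_{k=1}^{n} (1 - q^k)^24`. -/
noncomputable def ramanujanTau (n : ℕ) : ℤ :=
  ((Polynomial.X : Polynomial ℤ) * ∏ k ∈ Finset.Icc 1 n, (1 - Polynomial.X ^ k) ^ 24).coeff n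

open ArithmeticFunction in
/-- A convolution of divisor sums is a sum over all quadruples `m₁ n₁ + m₂ n₂ = n`. -/
lemma sum_antidiagonal_sigma_mul_sigma (s t n : ℕ) :
    ∑ x ∈ antidiagonal n, sigma s x.1 * sigma t x.2 =
      ∑ p ∈ (Icc 1 n ×ˢ Icc 1 n) ×ˢ (Icc 1 n ×ˢ Icc 1 n) with
        p.1.1 * p.2.1 + p.1.2 * p.2.2 = n, p.1.1 ^ s * p.1.2 ^ t := by
  have hσ (k a : ℕ) : sigma k a = ∑ x ∈ a.divisorsAntidiagonal, x.1 ^ k := by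
    rw [sigma_apply, Nat.sum_divisorsAntidiagonal fun d _ ↦ d ^ k]
  simp_rw [hσ, sum_mul_sum, ← sum_product']
  rw [sum_sigma']
  refine sum_nbij' (fun x ↦ ((x.2.1.1, x.2.2.1), (x.2.1.2, x.2.2.2)))
    (fun p ↦ ⟨(p.1.1 * p.2.1, p.1.2 * p.2.2), ((p.1.1, p.2.1), (p.1.2, p.2.2))⟩)
    ?_ ?_ ?_ ?_ ?_
  · rintro ⟨⟨a, b⟩, ⟨m, u⟩, ⟨l, v⟩⟩ h
    simp only [mem_sigma, HasAntidiagonal.mem_antidiagonal, mem_product,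
      Nat.mem_divisorsAntidiagonal, mem_filter, mem_Icc] at h ⊢
    obtain ⟨hab, ⟨rfl, h1⟩, rfl, h2⟩ := h
    obtain ⟨hm, hu⟩ := mul_ne_zero_iff.mp h1
    obtain ⟨hl, hv⟩ := mul_ne_zero_iff.mp h2
    have := Nat.le_mul_of_pos_right m (Nat.pos_of_ne_zero hu)
    have := Nat.le_mul_of_pos_left u (Nat.pos_of_ne_zero hm)
    have := Nat.le_mul_of_pos_right l (Nat.pos_of_ne_zero hv)
    have := Nat.le_mul_of_pos_left v (Nat.pos_of_ne_zero hl)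
    omega
  · rintro ⟨⟨m, l⟩, ⟨u, v⟩⟩ h
    simp only [mem_sigma, HasAntidiagonal.mem_antidiagonal, mem_product,
      Nat.mem_divisorsAntidiagonal, mem_filter, mem_Icc, mul_ne_zero_iff] at h ⊢
    obtain ⟨⟨⟨⟨hm, -⟩, hl, -⟩, ⟨hu, -⟩, hv, -⟩, h⟩ := h
    exact ⟨h, ⟨trivial, by omega, by omega⟩, trivial, by omega, by omega⟩
  · rintro ⟨⟨a, b⟩, ⟨m, u⟩, ⟨l, v⟩⟩ h
    simp only [mem_sigma, mem_product, Nat.mem_divisorsAntidiagonal] at h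
    obtain ⟨_, ⟨rfl, _⟩, rfl, _⟩ := h
    rfl
  · intro p _
    rfl
  · intro x _
    rfl

/-- The part of the quadruple sum with `n₂ < n₁`. -/
lemma sum_quadruples_gt_eq_sigmaPow2 (s t n : ℕ) :
    ∑ p ∈ (Icc 1 n ×ˢ Icc 1 n) ×ˢ (Icc 1 n ×ˢ Icc 1 n) with
      p.1.1 * p.2.1 + p.1.2 * p.2.2 = n ∧ p.2.2 < p.2.1, p.1.1 ^ s * p.1.2 ^ t =
      sigmaPow2 t s n := by
  refine sum_nbij' (fun p ↦ (p.1.swap, p.2.swap)) (fun p ↦ (p.1.swap, p.2.swap)) ?_ ?_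
    (fun _ _ ↦ rfl) (fun _ _ ↦ rfl) (fun _ _ ↦ mul_comm _ _)
  all_goals
    rintro ⟨⟨m, l⟩, ⟨u, v⟩⟩ h
    simp only [mem_product, mem_filter, mem_Icc, Prod.swap] at h ⊢
    omega

/-- The part of the quadruple sum of a prime with `n₁ = n₂`. -/
lemma sum_quadruples_eq_of_prime (s t : ℕ) {p : ℕ} (hp : p.Prime) :
    ∑ x ∈ (Icc 1 p ×ˢ Icc 1 p) ×ˢ (Icc 1 p ×ˢ Icc 1 p) with
      x.1.1 * x.2.1 + x.1.2 * x.2.2 = p ∧ x.2.1 = x.2.2, x.1.1 ^ s * x.1.2 ^ t =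
      ∑ m ∈ Ico 1 p, m ^ s * (p - m) ^ t := by
  symm
  refine sum_nbij' (fun m ↦ ((m, p - m), (1, 1))) (fun x ↦ x.1.1) ?_ ?_
    (fun _ _ ↦ rfl) ?_ (fun _ _ ↦ rfl)
  · intro m h
    simp only [mem_product, mem_filter, mem_Icc, mem_Ico, mul_one, and_true] at h ⊢
    omega
  · rintro ⟨⟨m, l⟩, ⟨u, v⟩⟩ h
    simp only [mem_product, mem_filter, mem_Icc, mem_Ico] at h ⊢
    obtain ⟨⟨⟨⟨hm, -⟩, hl, -⟩, ⟨hu, -⟩, hv, -⟩, h, -⟩ := h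
    refine ⟨hm, ?_⟩
    calc m ≤ m * u := Nat.le_mul_of_pos_right m hu
      _ < m * u + l * v := Nat.lt_add_of_pos_right (Nat.mul_pos hl hv)
      _ = p := h
  · rintro ⟨⟨m, l⟩, ⟨u, v⟩⟩ h
    simp only [mem_product, mem_filter, mem_Icc] at h
    obtain ⟨⟨⟨⟨hm, _⟩, hl, _⟩, _⟩, h, rfl⟩ := h
    rw [← add_mul] at h
    have hu : u = 1 := by
      rcases hp.eq_one_or_self_of_dvd _ ⟨u, h.symm⟩ with h1 | h1
      · omega
      · rw [h1] at h
        exact Nat.eq_of_mul_eq_mul_left hp.pos (by simpa using h)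
    subst hu
    simp only [Prod.mk.injEq, true_and, and_true]
    omega

open ArithmeticFunction in
/-- At a prime, a convolution of divisor sums splits according to `n₁ < n₂`, `n₂ < n₁` and
`n₁ = n₂`. -/
lemma sum_antidiagonal_sigma_mul_sigma_of_prime (s t : ℕ) {p : ℕ} (hp : p.Prime) :
    ∑ x ∈ antidiagonal p, sigma s x.1 * sigma t x.2 =
      sigmaPow2 s t p + sigmaPow2 t s p + ∑ m ∈ Ico 1 p, m ^ s * (p - m) ^ t := by
  rw [sum_antidiagonal_sigma_mul_sigma, ← sum_quadruples_eq_of_prime s t hp,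
    ← sum_quadruples_gt_eq_sigmaPow2 s t p, sigmaPow2]
  simp only [sum_filter, ← sum_add_distrib]
  refine sum_congr rfl fun x _ ↦ ?_
  rcases lt_trichotomy x.2.1 x.2.2 with h | h | h
  · simp [h, h.ne, h.le.not_gt]
  · simp [h]
  · simp [h, h.ne', h.le.not_gt]

lemma cast_sum_Ico_pow_mul_sub_pow {s : ℕ} (hs : s ≠ 0) (t n : ℕ) :
    ((∑ m ∈ Ico 1 n, m ^ s * (n - m) ^ t : ℕ) : ℚ) =
      ∑ m ∈ range n, (m : ℚ) ^ s * (n - m) ^ t := by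
  rcases n.eq_zero_or_pos with rfl | hn
  · simp
  rw [range_eq_Ico, sum_eq_sum_Ico_succ_bot hn, Nat.cast_sum]
  simp only [Nat.cast_zero, zero_pow hs, zero_mul, zero_add]
  refine sum_congr rfl fun m hm ↦ ?_
  rw [Nat.cast_mul, Nat.cast_pow, Nat.cast_pow, Nat.cast_sub (mem_Ico.mp hm).2.le]

lemma sum_range_pow_seven_mul_sub_pow_three (x : ℚ) (n : ℕ) :
    ∑ m ∈ range n, (m : ℚ) ^ 7 * (x - m) ^ 3 =
      x ^ 3 * (n ^ 8 / 8 - n ^ 7 / 2 + 7 * n ^ 6 / 12 - 7 * n ^ 4 / 24 + n ^ 2 / 12)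
      - 3 * x ^ 2 * (n ^ 9 / 9 - n ^ 8 / 2 + 2 * n ^ 7 / 3 - 7 * n ^ 5 / 15 + 2 * n ^ 3 / 9 - n / 30)
      + 3 * x * (n ^ 10 / 10 - n ^ 9 / 2 + 3 * n ^ 8 / 4 - 7 * n ^ 6 / 10 + n ^ 4 / 2
        - 3 * n ^ 2 / 20)
      - (n ^ 11 / 11 - n ^ 10 / 2 + 5 * n ^ 9 / 6 - n ^ 7 + n ^ 5 - n ^ 3 / 2 + 5 * n / 66) := by
  induction n with
  | zero => simp
  | succ n ih =>
    rw [sum_range_succ, ih]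
    push_cast
    ring

lemma sum_range_pow_five_mul_sub_pow_five (x : ℚ) (n : ℕ) :
    ∑ m ∈ range n, (m : ℚ) ^ 5 * (x - m) ^ 5 =
      x ^ 5 * (n ^ 6 / 6 - n ^ 5 / 2 + 5 * n ^ 4 / 12 - n ^ 2 / 12)
      - 5 * x ^ 4 * (n ^ 7 / 7 - n ^ 6 / 2 + n ^ 5 / 2 - n ^ 3 / 6 + n / 42)
      + 10 * x ^ 3 * (n ^ 8 / 8 - n ^ 7 / 2 + 7 * n ^ 6 / 12 - 7 * n ^ 4 / 24 + n ^ 2 / 12)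
      - 10 * x ^ 2 *
        (n ^ 9 / 9 - n ^ 8 / 2 + 2 * n ^ 7 / 3 - 7 * n ^ 5 / 15 + 2 * n ^ 3 / 9 - n / 30)
      + 5 * x * (n ^ 10 / 10 - n ^ 9 / 2 + 3 * n ^ 8 / 4 - 7 * n ^ 6 / 10 + n ^ 4 / 2
        - 3 * n ^ 2 / 20)
      - (n ^ 11 / 11 - n ^ 10 / 2 + 5 * n ^ 9 / 6 - n ^ 7 + n ^ 5 - n ^ 3 / 2 + 5 * n / 66) := by
  induction n with
  | zero => simp
  | succ n ih =>
    rw [sum_range_succ, ih]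
    push_cast
    ring

open Polynomial in
lemma Polynomial.iteratedDeriv_eval_zero (P : ℂ[X]) (n : ℕ) :
    iteratedDeriv n (fun x ↦ P.eval x) 0 = n.factorial * P.coeff n := by
  have h (n : ℕ) : iteratedDeriv n (fun x ↦ P.eval x) = fun x ↦ (derivative^[n] P).eval x := by
    induction n with
    | zero => simp
    | succ n ih =>
      ext x
      rw [iteratedDeriv_succ, ih, Function.iterate_succ_apply', Polynomial.deriv]
  rw [congrFun (h n) 0, ← coeff_zero_eq_eval_zero, coeff_iterate_derivative, zero_add,
    Nat.descFactorial_self, nsmul_eq_mul]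

/-- Locally uniform limits of holomorphic functions commute with iterated derivatives. -/
lemma TendstoLocallyUniformlyOn.iteratedDeriv {ι : Type*} {φ : Filter ι} {F : ι → ℂ → ℂ}
    {f : ℂ → ℂ} {U : Set ℂ} (hf : TendstoLocallyUniformlyOn F f φ U)
    (hF : ∀ i, DifferentiableOn ℂ (F i) U) (hU : IsOpen U) (n : ℕ) :
    TendstoLocallyUniformlyOn (fun i ↦ iteratedDeriv n (F i)) (iteratedDeriv n f) φ U := by
  have hdiff (i : ι) (n : ℕ) : DifferentiableOn ℂ (_root_.iteratedDeriv n (F i)) U := by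
    induction n with
    | zero => simpa using hF i
    | succ n ih =>
      rw [iteratedDeriv_succ]
      exact ih.deriv hU
  induction n with
  | zero => simpa using hf
  | succ n ih =>
    simp only [iteratedDeriv_succ]
    exact ih.deriv (.of_forall fun i ↦ hdiff i n) hU

open Polynomial in
/-- The truncation of `q ∏ (1 - q ^ k) ^ 24` used to define `ramanujanTau n` may be replaced by
any longer one. -/
lemma ramanujanTau_eq_coeff_of_le {n N : ℕ} (h : n ≤ N) :
    ramanujanTau n = ((X : ℤ[X]) * ∏ k ∈ Icc 1 N, (1 - X ^ k) ^ 24).coeff n := by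
  induction N, h using Nat.le_induction with
  | base => rfl
  | succ N h ih =>
    rw [ih, prod_Icc_succ_top (by omega)]
    obtain ⟨Q, hQ⟩ : (X ^ (N + 1) : ℤ[X]) ∣ (1 - X ^ (N + 1)) ^ 24 - 1 := by
      have := sub_dvd_pow_sub_pow (1 - X ^ (N + 1) : ℤ[X]) 1 24
      rwa [one_pow, sub_sub_cancel_left, neg_dvd] at this
    rw [eq_add_of_sub_eq' hQ, mul_add, mul_one, mul_add, coeff_add, left_eq_add]
    exact X_pow_dvd_iff.mp (((Dvd.intro Q rfl).mul_left _).mul_left _) n (by omega)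

open Polynomial ModularForm in
/-- `ramanujanTau` gives the Fourier coefficients of the modular discriminant. -/
lemma qExpansion_discriminant_coeff (n : ℕ) :
    (UpperHalfPlane.qExpansion 1 discriminant).coeff n = ramanujanTau n := by
  let P (N : ℕ) : ℤ[X] := X * ∏ k ∈ Icc 1 N, (1 - X ^ k) ^ 24
  let F (N : ℕ) (q : ℂ) : ℂ := ((P N).map (Int.castRingHom ℂ)).eval q
  have hF (N : ℕ) (q : ℂ) : F N q = q * (∏ i ∈ range N, (1 - q ^ (i + 1))) ^ 24 := by
    simp only [F, P, Polynomial.map_mul, Polynomial.map_prod, Polynomial.map_pow,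
      Polynomial.map_sub, Polynomial.map_one, map_X, eval_mul, eval_X, eval_prod, eval_pow,
      eval_sub, eval_one]
    rw [range_eq_Ico, prod_Ico_add' (fun k ↦ 1 - q ^ k), prod_pow]
    rfl
  have hlim : TendstoLocallyUniformlyOn F (UpperHalfPlane.cuspFunction 1 discriminant)
      Filter.atTop (Metric.ball 0 1) := by
    have hprod := multipliableLocallyUniformlyOn_one_sub_pow.hasProdLocallyUniformlyOn
      |>.tendstoLocallyUniformlyOn_finsetRange
    have hcont : ContinuousOn (fun q : ℂ ↦ ∏' i : ℕ, (1 - q ^ (i + 1))) (Metric.ball 0 1) :=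
      differentiableOn_tprod_one_sub_pow.continuousOn
    have hpow (k : ℕ) : TendstoLocallyUniformlyOn
        (fun N (q : ℂ) ↦ q * (∏ i ∈ range N, (1 - q ^ (i + 1))) ^ k)
        (fun q ↦ q * (∏' i, (1 - q ^ (i + 1))) ^ k) Filter.atTop (Metric.ball 0 1) := by
      induction k with
      | zero =>
        intro u hu x _
        exact ⟨Set.univ, Filter.univ_mem,
          .of_forall fun _ _ _ ↦ by simpa using refl_mem_uniformity hu⟩
      | succ k ih =>
        simp only [pow_succ, ← mul_assoc]
        exact ih.mul₀ hprod (continuousOn_id.mul (hcont.pow k)) hcont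
    refine ((hpow 24).congr fun N q _ ↦ (hF N q).symm).congr_right fun q hq ↦ ?_
    rw [discriminant_cuspFunction_eqOn hq]
    simp only [(multipliable_one_sub_pow (by simpa using hq)).tprod_pow 24]
  have h0 : (0 : ℂ) ∈ Metric.ball (0 : ℂ) 1 := Metric.mem_ball_self one_pos
  have h1 := (hlim.iteratedDeriv (fun N ↦ Polynomial.differentiableOn _)
    Metric.isOpen_ball n).tendsto_at h0
  have h2 : ∀ᶠ N in Filter.atTop, iteratedDeriv n (F N) 0 = n.factorial * ramanujanTau n := by
    filter_upwards [Filter.eventually_ge_atTop n] with N hN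
    rw [Polynomial.iteratedDeriv_eval_zero, coeff_map, ramanujanTau_eq_coeff_of_le hN]
    rfl
  rw [UpperHalfPlane.qExpansion_coeff, tendsto_nhds_unique_of_eventuallyEq h1 tendsto_const_nhds h2,
    inv_mul_cancel_left₀ (by exact_mod_cast n.factorial_ne_zero)]

open ModularForm EisensteinSeries UpperHalfPlane MatrixGroups in
/-- `E₈ = E₄²`, as the space of modular forms of level one and weight eight is a line. -/
lemma qExpansion_E_eight_eq_qExpansion_E₄_sq :
    qExpansion 1 (E (k := 8) (by norm_num)) = qExpansion 1 E₄ ^ 2 := by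
  have hrank : Module.rank ℂ (ModularForm 𝒮ℒ 8) = 1 :=
    (ModularForm.rank_eq_one_add_rank_cuspForm (by norm_num) ⟨4, rfl⟩).trans
      ((congrArg (1 + ·) (CuspForm.rank_eq_zero_of_weight_lt_twelve (by norm_num))).trans
        (by norm_cast))
  obtain ⟨c, hc⟩ : ∃ c : ℂ, c • E (k := 8) (by norm_num : 3 ≤ 8) = E₄.mul E₄ :=
    (finrank_eq_one_iff_of_nonzero' (E (k := 8) (by norm_num)) (E_ne_zero _ ⟨4, rfl⟩)).mp
      (Module.rank_eq_one_iff_finrank_eq_one.mp hrank) _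
  have hq : c • qExpansion 1 (E (k := 8) (by norm_num)) = qExpansion 1 E₄ ^ 2 := by
    rw [pow_two, ← ModularForm.qExpansion_mul one_pos one_mem_strictPeriods_SL E₄ E₄,
      ← ModularForm.qExpansion_smul one_pos one_mem_strictPeriods_SL c _]
    exact congrArg (qExpansion 1) (congrArg DFunLike.coe hc)
  have hc1 : c = 1 := by
    simpa [pow_two, PowerSeries.coeff_mul, -PowerSeries.coeff_zero_eq_constantCoeff,
      E_qExpansion_coeff_zero _ (⟨2, rfl⟩ : Even 4),
      E_qExpansion_coeff_zero _ (⟨4, rfl⟩ : Even 8)] using congrArg (PowerSeries.coeff 0) hq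
  rw [← hq, hc1, one_smul]

open ModularForm EisensteinSeries UpperHalfPlane MatrixGroups in
/-- `1728 Δ = E₈ E₄ - E₆²` on `q`-expansions. -/
lemma qExpansion_discriminant_eq :
    (1728 : ℂ) • qExpansion 1 discriminant =
      qExpansion 1 (E (k := 8) (by norm_num)) * qExpansion 1 E₄ - qExpansion 1 E₆ ^ 2 := by
  have h : (((1728 : ℂ) • CuspForm.discriminant : CuspForm 𝒮ℒ 12) : ℍ → ℂ) =
      (ModularForm.mcast (by decide) (E₄.pow 3) - ModularForm.mcast (by decide) (E₆.pow 2) :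
        ModularForm 𝒮ℒ 12) := by
    ext z
    change 1728 * discriminant z = E₄ z ^ 3 - E₆ z ^ 2
    rw [discriminant_eq_E₄_cube_sub_E₆_sq]
    ring
  have hq := ModularForm.qExpansion_smul one_pos one_mem_strictPeriods_SL 1728
    CuspForm.discriminant
  rw [qExpansion_E_eight_eq_qExpansion_E₄_sq]
  refine hq.symm.trans ?_
  refine (congrArg (qExpansion 1) h).trans ?_
  simp only [FunLike.coe_sub, coe_mcast,
    ModularForm.qExpansion_sub one_pos one_mem_strictPeriods_SL,
    ModularForm.qExpansion_pow one_pos one_mem_strictPeriods_SL]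
  ring

open ModularForm EisensteinSeries UpperHalfPlane ArithmeticFunction in
lemma qExpansion_E_eq {k : ℕ} (hk : 3 ≤ k) (hk2 : Even k) :
    qExpansion 1 (E hk) = 1 + PowerSeries.C (-(2 * k / bernoulli k : ℂ)) *
      PowerSeries.mk fun n ↦ (sigma (k - 1) n : ℂ) := by
  ext n
  rw [E_qExpansion_coeff hk hk2, map_add, PowerSeries.coeff_C_mul, PowerSeries.coeff_mk,
    PowerSeries.coeff_one]
  split_ifs with h <;> simp [h]

open ModularForm EisensteinSeries UpperHalfPlane ArithmeticFunction in
/-- Coefficient comparison in `1728 Δ = E₈ E₄ - E₆²`. -/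
lemma ramanujanTau_eq_sum_sigma (n : ℕ) :
    1728 * (ramanujanTau n : ℚ) =
      240 * sigma 3 n + 480 * sigma 7 n + 1008 * sigma 5 n
        + 115200 * (∑ x ∈ antidiagonal n, sigma 7 x.1 * sigma 3 x.2 : ℕ)
        - 254016 * (∑ x ∈ antidiagonal n, sigma 5 x.1 * sigma 5 x.2 : ℕ) := by
  let G (k : ℕ) : PowerSeries ℂ := PowerSeries.mk fun n ↦ (sigma k n : ℂ)
  have h4 : qExpansion 1 E₄ = 1 + PowerSeries.C 240 * G 3 := by
    rw [E₄, qExpansion_E_eq _ ⟨2, rfl⟩, show bernoulli 4 = -1 / 30 by decide +kernel]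
    norm_num [G]
  have h6 : qExpansion 1 E₆ = 1 + PowerSeries.C (-504) * G 5 := by
    rw [E₆, qExpansion_E_eq _ ⟨3, rfl⟩, show bernoulli 6 = 1 / 42 by decide +kernel]
    norm_num [G]
  have h8 : qExpansion 1 (E (k := 8) (by norm_num)) = 1 + PowerSeries.C 480 * G 7 := by
    rw [qExpansion_E_eq _ ⟨4, rfl⟩, show bernoulli 8 = -1 / 30 by decide +kernel]
    norm_num [G]
  have hG (s t : ℕ) : (G s * G t).coeff n =
      ((∑ x ∈ antidiagonal n, sigma s x.1 * sigma t x.2 : ℕ) : ℂ) := by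
    simp [G, PowerSeries.coeff_mul]
  have hexp (a b c A B C : PowerSeries ℂ) : (1 + a * A) * (1 + b * B) - (1 + c * C) ^ 2 =
      a * A + b * B + a * (b * (A * B)) - (c * C + c * C) - c * (c * (C * C)) := by
    ring
  have h := congrArg (PowerSeries.coeff n) qExpansion_discriminant_eq
  rw [h4, h6, h8, PowerSeries.coeff_smul, qExpansion_discriminant_coeff, hexp] at h
  simp only [map_add, map_sub, PowerSeries.coeff_C_mul, hG] at h
  simp only [G, PowerSeries.coeff_mk, smul_eq_mul] at h
  rw [← Rat.cast_inj (α := ℂ)]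
  push_cast at h ⊢
  linear_combination h

theorem lehmer_criterion (p : ℕ) (hp : p.Prime) :
    ramanujanTau p = 0
      ↔ (200 / 3 : ℚ) * ((sigmaPow2 7 3 p : ℚ) + (sigmaPow2 3 7 p : ℚ))
          - 294 * (sigmaPow2 5 5 p : ℚ)
        = (p : ℚ) ^ 11 / 396 - 5 * (p : ℚ) ^ 7 / 6 + 137 * (p : ℚ) ^ 5 / 36
          + 19 * (p : ℚ) ^ 3 / 9 - 1205 * (p : ℚ) / 198 - 1 := by
  have hσ (k : ℕ) : (ArithmeticFunction.sigma k p : ℚ) = 1 + p ^ k := by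
    simp [ArithmeticFunction.sigma_apply, hp.sum_divisors, add_comm]
  have h := ramanujanTau_eq_sum_sigma p
  simp only [sum_antidiagonal_sigma_mul_sigma_of_prime _ _ hp, Nat.cast_add,
    cast_sum_Ico_pow_mul_sub_pow (by norm_num : 7 ≠ 0),
    cast_sum_Ico_pow_mul_sub_pow (by norm_num : 5 ≠ 0), hσ,
    sum_range_pow_seven_mul_sub_pow_three, sum_range_pow_five_mul_sub_pow_five] at h
  rw [← Int.cast_eq_zero (α := ℚ), ← sub_eq_zero (b := _ - (1 : ℚ))]
  refine Eq.congr_left ?_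
  linear_combination h / 1728
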